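/- Let I = Borel(M,N) be a two-Borel ideal and let μ be a monomial divisible by both M and N. Then every sink of →Γ_μ(I) of type M contains M among its elements, and every sink of type N contains N among its elements. Moreover every sink of →Γ_μ(I) has the form {M} ∪ Z_M where Z_M is a sink of →Γ_{μ/M}(I), or {N} ∪ Z_N where Z_N is a sink of →Γ_{μ/N}(I). -/

import Mathlib

/-!  Monomials in `K[x_1,…,x_n]` are identified with their exponent vectors in `Fin n → ℕ`
(`0`-based indexing: `x_1` corresponds to index `0`).  -/

variable {n : ℕ}

/-- Cumulative exponent vector (`0`-based): `cexp m i = m i + m (i+1) + ⋯ + m (n-1)`,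
so `cexp m i` is the paper's `σ_{i+1}(m)`, and `cexp m n = 0` is the convention
`σ_{n+1}(m) = 0`. -/
def cexp (m : Fin n → ℕ) (i : ℕ) : ℕ :=
  ∑ k : Fin n, if i ≤ (k : ℕ) then m k else 0

/-- `mshift m src tgt` is the exponent vector of `(x_tgt / x_src) · m` (only used when
`src ≠ tgt` and `x_src` divides `m`).  Thus `mshift m j i` is the Borel move `B_{j→i}(m)`
(for `i < j`) and `mshift m i j` is the reverse Borel move `RB_{i→j}(m)` (for `i < j`). -/
def mshift (m : Fin n → ℕ) (src tgt : Fin n) : Fin n → ℕ :=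
  fun k => if k = tgt then m tgt + 1 else if k = src then m src - 1 else m k

/-- `BorelStep a b` : `b` is obtained from `a` by a single Borel move `B_{j→i}`, `i < j`. -/
def BorelStep (a b : Fin n → ℕ) : Prop :=
  ∃ i j : Fin n, i < j ∧ 0 < a j ∧ b = mshift a j i

/-- `InBorel m m'` : `m ∈ Borel(m')`, i.e. `m` is obtained from `m'` by a finite (possibly
empty) sequence of Borel moves. -/
def InBorel (m m' : Fin n → ℕ) : Prop := Relation.ReflTransGen BorelStep m' m

/-- Divisibility of monomials: `m` divides `μ`. -/
def mDvd (m μ : Fin n → ℕ) : Prop := ∀ k, m k ≤ μ k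

/-- `mLexLt m m'` : `m` is lexicographically smaller than `m'` (lex order with
`x_1 > x_2 > ⋯ > x_n`); i.e. `m` comes *later* than `m'` in the lex listing of monomials. -/
def mLexLt (m m' : Fin n → ℕ) : Prop :=
  ∃ i : Fin n, (∀ k, k < i → m k = m' k) ∧ m i < m' i

/-- Total degree of a monomial. -/
def mDeg (m : Fin n → ℕ) : ℕ := ∑ k, m k

/-- A vertex of the fiber graph `Γ_μ(I)`, where `G` is the minimal monomial generating set of
`I`: a multiset of elements of `G` whose product (sum of exponent vectors) is `μ`. -/
def FiberVertex (G : Set (Fin n → ℕ)) (μ : Fin n → ℕ) (Z : Multiset (Fin n → ℕ)) : Prop :=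
  (∀ w ∈ Z, w ∈ G) ∧ Z.sum = μ

/-- Adjacency in the fiber graph `Γ_μ(I)`: `Z` is obtained from `Z'` by applying a Borel move
`B_{j→i}` to one element and the corresponding reverse Borel move `RB_{i→j}` to another,
leaving all other elements unchanged. -/
def FiberAdj (G : Set (Fin n → ℕ)) (μ : Fin n → ℕ) (Z Z' : Multiset (Fin n → ℕ)) : Prop :=
  FiberVertex G μ Z ∧ FiberVertex G μ Z' ∧
  ∃ (W : Multiset (Fin n → ℕ)) (u v u' v' : Fin n → ℕ) (i j : Fin n),
    i < j ∧ Z = u ::ₘ v ::ₘ W ∧ Z' = u' ::ₘ v' ::ₘ W ∧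
    0 < u' j ∧ u = mshift u' j i ∧ 0 < v' i ∧ v = mshift v' i j

/-- `G_M`: the minimal monomial generators of `Borel(M)`, i.e. (for the equigenerated Borel
ideal `I = Borel(M,N)`) the degree-`d` monomials in `Borel(M)`. -/
def gensM (M : Fin n → ℕ) : Set (Fin n → ℕ) := {w | InBorel w M}

/-- `G_N = gens(I) ∖ G_M` for `I = Borel(M,N)`. -/
def gensN (M N : Fin n → ℕ) : Set (Fin n → ℕ) := {w | InBorel w N ∧ ¬ InBorel w M}

/-- The minimal monomial generating set `G` of the two-Borel ideal `I = Borel(M,N)`. -/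
def gens2 (M N : Fin n → ℕ) : Set (Fin n → ℕ) := {w | InBorel w M ∨ InBorel w N}

/-- The fiber sink variable order: `varBefore M N w₁ w₂` says the variable `Y_{w₁}` comes
(strictly) before `Y_{w₂}`.  First come the `w ∈ G_N`, with `Y_N` first (lex-smaller `w`
first), then the `w ∈ G_M`, with `Y_M` last (lex-larger `w` first). -/
def varBefore (M N : Fin n → ℕ) (w₁ w₂ : Fin n → ℕ) : Prop :=
  (w₁ ∈ gensN M N ∧ w₂ ∈ gensM M) ∨
  (w₁ ∈ gensN M N ∧ w₂ ∈ gensN M N ∧ mLexLt w₁ w₂) ∨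
  (w₁ ∈ gensM M ∧ w₂ ∈ gensM M ∧ mLexLt w₂ w₁)

/-- The fiber sink order (reverse lexicographic order induced by the fiber sink variable
order): `laterThan M N Z Z'` says the monomial `∏_{w ∈ Z} Y_w` comes strictly *later* than
`∏_{w ∈ Z'} Y_w`; i.e. at the last variable (in the fiber sink variable order) where the two
multisets have different multiplicities, `Z` has the larger multiplicity. -/
def laterThan (M N : Fin n → ℕ) (Z Z' : Multiset (Fin n → ℕ)) : Prop :=
  ∃ w, Z'.count w < Z.count w ∧ ∀ u, varBefore M N w u → Z.count u = Z'.count u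

/-- A sink of the directed fiber graph `→Γ_μ(I)` for `I = Borel(M,N)` (edges are directed
toward the endpoint that is later in the fiber sink order): a vertex that is later than all
of its neighbors. -/
def IsSink (M N μ : Fin n → ℕ) (Z : Multiset (Fin n → ℕ)) : Prop :=
  FiberVertex (gens2 M N) μ Z ∧
  ∀ Z', FiberAdj (gens2 M N) μ Z Z' → Z' ≠ Z → laterThan M N Z Z'

theorem mLexLt_iff_toLex (a b : Fin n → ℕ) : mLexLt a b ↔ toLex a < toLex b := Iff.rfl

theorem mshift_add (w : Fin n → ℕ) (i j : Fin n) (hij : i ≠ j) (h : 0 < w i) :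
    mshift w i j + Pi.single i 1 = w + Pi.single j 1 := by
  funext k
  simp only [mshift, Pi.add_apply, Pi.single_apply]
  by_cases h1 : k = j
  · subst h1
    simp [hij.symm]
  · by_cases h2 : k = i
    · subst h2
      simp [h1]
      omega
    · simp [h1, h2]

theorem cexp_add (a b : Fin n → ℕ) (k : ℕ) : cexp (a + b) k = cexp a k + cexp b k := by
  simp only [cexp, ← Finset.sum_add_distrib]
  refine Finset.sum_congr rfl fun l _ => ?_
  split_ifs <;> simp

theorem cexp_single (j : Fin n) (k : ℕ) :
    cexp (Pi.single j 1) k = if k ≤ (j : ℕ) then 1 else 0 := by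
  unfold cexp
  rw [Finset.sum_eq_single j]
  · simp
  · intro b _ hb
    simp [hb]
  · simp

theorem cexp_mshift (w : Fin n → ℕ) (i j : Fin n) (hij : i ≠ j) (h : 0 < w i) (k : ℕ) :
    cexp (mshift w i j) k + (if k ≤ (i : ℕ) then 1 else 0)
      = cexp w k + (if k ≤ (j : ℕ) then 1 else 0) := by
  have := congrArg (fun f => cexp f k) (mshift_add w i j hij h)
  simpa only [cexp_add, cexp_single] using this

theorem cexp_anti (w : Fin n → ℕ) {k l : ℕ} (h : k ≤ l) : cexp w l ≤ cexp w k := by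
  refine Finset.sum_le_sum fun m _ => ?_
  split_ifs <;> omega

theorem cexp_zero (w : Fin n → ℕ) : cexp w 0 = mDeg w := by simp [cexp, mDeg]

theorem cexp_succ (w : Fin n → ℕ) (j : Fin n) : cexp w j = w j + cexp w (j + 1) := by
  have h : w j = ∑ k : Fin n, if k = j then w k else 0 := by simp
  unfold cexp
  conv_rhs => rw [h]
  rw [← Finset.sum_add_distrib]
  refine Finset.sum_congr rfl fun l _ => ?_
  by_cases h1 : l = j
  · subst h1; simp
  · have : (l : ℕ) ≠ j := fun h => h1 (Fin.ext h)
    simp only [h1, if_false]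
    split_ifs <;> omega

theorem mshift_back (w : Fin n → ℕ) (i j : Fin n) (hij : i ≠ j) (h : 0 < w i) :
    mshift (mshift w i j) j i = w := by
  funext k
  simp only [mshift]
  by_cases h1 : k = i
  · subst h1
    simp [hij]; omega
  · by_cases h2 : k = j
    · subst h2; simp [h1]
    · simp [h1, h2]

theorem exists_step (w P : Fin n → ℕ) (hc : ∀ k, cexp w k ≤ cexp P k) (hd : mDeg w = mDeg P)
    (hne : w ≠ P) : ∃ i j : Fin n, i < j ∧ 0 < w i ∧ w j < P j ∧
      (∀ k, cexp (mshift w i j) k ≤ cexp P k) := by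
  obtain ⟨j0, hj0⟩ := Function.ne_iff.mp hne
  obtain ⟨j, hj, hjm⟩ := Finset.exists_max_image (Finset.univ.filter fun j => w j ≠ P j) id
    ⟨j0, by simpa using hj0⟩
  simp only [Finset.mem_filter, Finset.mem_univ, true_and, id] at hj hjm
  have htail : cexp w (j + 1) = cexp P (j + 1) := by
    refine Finset.sum_congr rfl fun l _ => ?_
    split_ifs with hl
    · by_contra hcon
      have := hjm l hcon
      rw [Fin.le_def] at this
      omega
    · rfl
  have e1 := cexp_succ w j
  have e2 := cexp_succ P j
  have e3 := hc j
  have hlt : w j < P j := by omega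
  have hclt : cexp w j < cexp P j := by omega
  have key : ∀ k : ℕ, k ≤ j → (∀ i : Fin n, i < j → k ≤ i → w i = 0) → cexp w k = cexp w j := by
    intro k hk hz
    refine Finset.sum_congr rfl fun l _ => ?_
    by_cases h1 : (j : ℕ) ≤ l
    · simp [h1, hk.trans h1]
    · simp only [h1, if_false]
      split_ifs with h2
      · exact hz l (by rw [Fin.lt_def]; omega) h2
      · rfl
  have hex : ∃ i : Fin n, i < j ∧ 0 < w i := by
    by_contra hcon
    push Not at hcon
    have h0 := key 0 (Nat.zero_le _) (fun i hi _ => by have := hcon i hi; omega)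
    have h1 := cexp_anti P (Nat.zero_le (j : ℕ))
    rw [cexp_zero] at h0 h1
    omega
  obtain ⟨i0, hi0⟩ := hex
  obtain ⟨i, hi, him⟩ := Finset.exists_max_image
    (Finset.univ.filter fun i : Fin n => i < j ∧ 0 < w i) id ⟨i0, by simpa using hi0⟩
  simp only [Finset.mem_filter, Finset.mem_univ, true_and, id] at hi him
  refine ⟨i, j, hi.1, hi.2, hlt, fun k => ?_⟩
  have e := cexp_mshift w i j hi.1.ne hi.2 k
  have hk := hc k
  have hij : (i : ℕ) < j := hi.1
  by_cases h1 : k ≤ (i : ℕ)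
  · have h2 : k ≤ (j : ℕ) := by omega
    simp only [h1, h2, if_true] at e
    omega
  · by_cases h2 : k ≤ (j : ℕ)
    · simp only [h1, h2, if_true, if_false] at e
      have := key k h2 (fun l hl hkl => by
        by_contra hcon
        have := him l ⟨hl, by omega⟩
        rw [Fin.le_def] at this
        omega)
      have := cexp_anti P h2
      omega
    · simp only [h1, h2, if_false] at e
      omega

theorem mDeg_mshift (w : Fin n → ℕ) (i j : Fin n) (hij : i ≠ j) (h : 0 < w i) :
    mDeg (mshift w i j) = mDeg w := by
  have := cexp_mshift w i j hij h 0
  simpa [cexp_zero] using this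

theorem inBorel_cexp {w P : Fin n → ℕ} (h : InBorel w P) :
    (∀ k, cexp w k ≤ cexp P k) ∧ mDeg w = mDeg P := by
  induction h with
  | refl => exact ⟨fun _ => le_rfl, rfl⟩
  | tail _ hs ih =>
    obtain ⟨i, j, hij, hpos, rfl⟩ := hs
    refine ⟨fun k => ?_, (mDeg_mshift _ _ _ hij.ne' hpos).trans ih.2⟩
    have e := cexp_mshift _ j i hij.ne' hpos k
    have := ih.1 k
    have hij' : (i : ℕ) < j := hij
    split_ifs at e <;> omega

theorem inBorel_of_cexp (P : Fin n → ℕ) : ∀ (t : ℕ) (w : Fin n → ℕ),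
    ∑ k : Fin n, (cexp P k - cexp w k) ≤ t → (∀ k, cexp w k ≤ cexp P k) → mDeg w = mDeg P →
    InBorel w P := by
  intro t
  induction t with
  | zero =>
    intro w ht hc hd
    by_cases hne : w = P
    · subst hne; exact Relation.ReflTransGen.refl
    · obtain ⟨i, j, hij, hi, hj, hc'⟩ := exists_step w P hc hd hne
      exfalso
      have e := cexp_mshift w i j hij.ne hi j
      have hij' : (i : ℕ) < j := hij
      have h1 : ¬ (j : ℕ) ≤ i := by omega
      simp only [h1, le_refl, if_true, if_false] at e
      have := hc' j
      have h2 := Finset.single_le_sum (f := fun k : Fin n => cexp P k - cexp w k)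
        (fun _ _ => Nat.zero_le _) (Finset.mem_univ j)
      omega
  | succ t ih =>
    intro w ht hc hd
    by_cases hne : w = P
    · subst hne; exact Relation.ReflTransGen.refl
    · obtain ⟨i, j, hij, hi, hj, hc'⟩ := exists_step w P hc hd hne
      have hij' : (i : ℕ) < j := hij
      have hlt : ∑ k : Fin n, (cexp P k - cexp (mshift w i j) k)
          < ∑ k : Fin n, (cexp P k - cexp w k) := by
        refine Finset.sum_lt_sum (fun k _ => ?_) ⟨j, Finset.mem_univ _, ?_⟩
        · have e := cexp_mshift w i j hij.ne hi k
          split_ifs at e <;> omega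
        · have e := cexp_mshift w i j hij.ne hi j
          have h1 : ¬ (j : ℕ) ≤ i := by omega
          simp only [h1, le_refl, if_true, if_false] at e
          have := hc' j
          omega
      have hB := ih (mshift w i j) (by omega) hc' ((mDeg_mshift _ _ _ hij.ne hi).trans hd)
      refine Relation.ReflTransGen.tail hB ⟨i, j, hij, ?_, (mshift_back w i j hij.ne hi).symm⟩
      simp [mshift]

theorem mshift_lex_up (u : Fin n → ℕ) (i j : Fin n) (hij : i < j) :
    mLexLt u (mshift u j i) := by
  refine ⟨i, fun k hk => ?_, by simp [mshift]⟩
  simp [mshift, hk.ne, (hk.trans hij).ne]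

theorem mshift_lex_down (w : Fin n → ℕ) (i j : Fin n) (hij : i < j) (h : 0 < w i) :
    mLexLt (mshift w i j) w := by
  have := mshift_lex_up (mshift w i j) i j hij
  rwa [mshift_back w i j hij.ne h] at this

/-- The move available at an element `w ≠ P` of a vertex. -/
theorem exists_move {P w μ : Fin n → ℕ} {W : Multiset (Fin n → ℕ)} (hw : InBorel w P)
    (hne : w ≠ P) (hP : mDvd P μ) (hsum : (w ::ₘ W).sum = μ) :
    ∃ i j : Fin n, i < j ∧ 0 < w i ∧ InBorel (mshift w i j) P ∧ ∃ u ∈ W, 0 < u j := by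
  obtain ⟨hc, hd⟩ := inBorel_cexp hw
  obtain ⟨i, j, hij, hi, hj, hc'⟩ := exists_step w P hc hd hne
  refine ⟨i, j, hij, hi,
    inBorel_of_cexp P _ _ le_rfl hc' ((mDeg_mshift _ _ _ hij.ne hi).trans hd), ?_⟩
  by_contra hcon
  push Not at hcon
  have hz : ∀ V : Multiset (Fin n → ℕ), (∀ u ∈ V, u j ≤ 0) → V.sum j = 0 := by
    intro V
    induction V using Multiset.induction with
    | empty => simp
    | cons a V ih =>
      intro h
      have h1 := h a (Multiset.mem_cons_self _ _)
      have h2 := ih fun u hu => h u (Multiset.mem_cons_of_mem hu)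
      simp [h2]; omega
  have h1 := hz W hcon
  have h2 := hP j
  rw [← hsum, Multiset.sum_cons, Pi.add_apply, h1] at h2
  omega

theorem varBefore_irrefl (M N w : Fin n → ℕ) : ¬ varBefore M N w w := by
  rintro (⟨h1, h2⟩ | ⟨_, _, h⟩ | ⟨_, _, h⟩)
  · exact h1.2 h2
  · exact lt_irrefl _ ((mLexLt_iff_toLex _ _).1 h)
  · exact lt_irrefl _ ((mLexLt_iff_toLex _ _).1 h)

theorem gens2_borel {M N u : Fin n → ℕ} (h : u ∈ gens2 M N) {i j : Fin n} (hij : i < j)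
    (hu : 0 < u j) : mshift u j i ∈ gens2 M N := by
  rcases h with h | h
  · exact Or.inl (Relation.ReflTransGen.tail h ⟨i, j, hij, hu, rfl⟩)
  · exact Or.inr (Relation.ReflTransGen.tail h ⟨i, j, hij, hu, rfl⟩)

/-- A move whose result contains an element after both moved elements contradicts sinkness. -/
theorem sink_contra {M N μ u w t : Fin n → ℕ} {W : Multiset (Fin n → ℕ)} {i j : Fin n}
    (hs : IsSink M N μ (w ::ₘ u ::ₘ W)) (hij : i < j) (hu : 0 < u j) (hw : 0 < w i)
    (hw' : mshift w i j ∈ gens2 M N) (ht : t = mshift w i j ∨ t = mshift u j i)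
    (h1 : varBefore M N w t) (h2 : varBefore M N u t) : False := by
  have htw : t ≠ w := fun h => varBefore_irrefl M N w (h ▸ h1)
  have htu : t ≠ u := fun h => varBefore_irrefl M N u (h ▸ h2)
  obtain ⟨⟨hG, hsum⟩, hl⟩ := hs
  have hcount : (w ::ₘ u ::ₘ W).count t < (mshift w i j ::ₘ mshift u j i ::ₘ W).count t := by
    rw [Multiset.count_cons_of_ne htw, Multiset.count_cons_of_ne htu]
    rcases ht with rfl | rfl
    · rw [Multiset.count_cons_self]
      exact Nat.lt_succ_of_le (Multiset.count_le_count_cons _ _ _)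
    · refine lt_of_lt_of_le ?_ (Multiset.count_le_count_cons _ _ _)
      rw [Multiset.count_cons_self]
      exact Nat.lt_succ_self _
  have hV : FiberVertex (gens2 M N) μ (mshift w i j ::ₘ mshift u j i ::ₘ W) := by
    refine ⟨fun x hx => ?_, ?_⟩
    · rw [Multiset.mem_cons, Multiset.mem_cons] at hx
      rcases hx with rfl | rfl | hx
      · exact hw'
      · exact gens2_borel (hG u (by simp)) hij hu
      · exact hG x (by simp [hx])
    · rw [← hsum]
      simp only [Multiset.sum_cons]
      have e1 := mshift_add w i j hij.ne hw
      have e2 := mshift_add u j i hij.ne' hu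
      funext k
      have e1 := congrFun e1 k
      have e2 := congrFun e2 k
      simp only [Pi.add_apply] at *
      omega
  have hadj : FiberAdj (gens2 M N) μ (w ::ₘ u ::ₘ W) (mshift w i j ::ₘ mshift u j i ::ₘ W) := by
    refine ⟨⟨hG, hsum⟩, hV, W, w, u, mshift w i j, mshift u j i, i, j, hij, rfl, rfl, ?_,
      (mshift_back w i j hij.ne hw).symm, ?_, (mshift_back u j i hij.ne' hu).symm⟩
    · simp [mshift]
    · simp [mshift]
  obtain ⟨x, hx, hx'⟩ := hl _ hadj (fun h => by rw [h] at hcount; exact lt_irrefl _ hcount)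
  by_cases hxw : x = w
  · subst hxw
    have := hx' t h1
    omega
  by_cases hxu : x = u
  · subst hxu
    have := hx' t h2
    omega
  rw [Multiset.count_cons_of_ne hxw, Multiset.count_cons_of_ne hxu] at hx
  have a1 := Multiset.count_le_count_cons x (mshift u j i) W
  have a2 := Multiset.count_le_count_cons x (mshift w i j) (mshift u j i ::ₘ W)
  omega

theorem sink_tail {M N μ P : Fin n → ℕ} {Z : Multiset (Fin n → ℕ)}
    (hs : IsSink M N μ (P ::ₘ Z)) : IsSink M N (μ - P) Z := by
  obtain ⟨⟨hG, hsum⟩, hl⟩ := hs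
  have hPG := hG P (by simp)
  rw [Multiset.sum_cons] at hsum
  have lift : ∀ Y, FiberVertex (gens2 M N) (μ - P) Y → FiberVertex (gens2 M N) μ (P ::ₘ Y) := by
    rintro Y ⟨h1, h2⟩
    refine ⟨fun x hx => ?_, ?_⟩
    · rcases Multiset.mem_cons.1 hx with rfl | hx
      · exact hPG
      · exact h1 x hx
    · rw [Multiset.sum_cons, h2, ← hsum]
      funext k
      simp
  refine ⟨⟨fun x hx => hG x (by simp [hx]), ?_⟩, ?_⟩
  · rw [← hsum]; funext k; simp
  · rintro Z' ⟨h1, h2, W, u, v, u', v', i, j, hij, rfl, rfl, r⟩ hne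
    obtain ⟨x, hx, hx'⟩ := hl (P ::ₘ u' ::ₘ v' ::ₘ W)
      ⟨lift _ h1, lift _ h2, P ::ₘ W, u, v, u', v', i, j, hij, by
        rw [Multiset.cons_swap v P, Multiset.cons_swap u P], by
        rw [Multiset.cons_swap v' P, Multiset.cons_swap u' P], r⟩
      (fun h => hne ((Multiset.cons_inj_right P).1 h))
    refine ⟨x, ?_, fun y hy => ?_⟩
    · rw [Multiset.count_cons (b := P), Multiset.count_cons (b := P)] at hx
      omega
    · have := hx' y hy
      rw [Multiset.count_cons (b := P), Multiset.count_cons (b := P)] at this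
      omega

theorem exists_lex_min (Z : Multiset (Fin n → ℕ)) (p : (Fin n → ℕ) → Prop) (h : ∃ w ∈ Z, p w) :
    ∃ w ∈ Z, p w ∧ ∀ u ∈ Z, p u → toLex w ≤ toLex u := by
  classical
  obtain ⟨w, hw, hp⟩ := h
  obtain ⟨m, hm, hmin⟩ := Finset.exists_min_image (Z.toFinset.filter p) toLex
    ⟨w, by simp [hw, hp]⟩
  simp only [Finset.mem_filter, Multiset.mem_toFinset] at hm hmin
  exact ⟨m, hm.1, hm.2, fun u hu hpu => hmin u ⟨hu, hpu⟩⟩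

theorem sink_typeM {M N μ : Fin n → ℕ} (hMμ : mDvd M μ) (Z : Multiset (Fin n → ℕ))
    (hs : IsSink M N μ Z) (hM : ∃ w ∈ Z, w ∈ gensM M) : M ∈ Z := by
  obtain ⟨w, hw, hwM, hmin⟩ := exists_lex_min Z (· ∈ gensM M) hM
  by_contra hcon
  have hne : w ≠ M := fun h => hcon (h ▸ hw)
  obtain ⟨W0, rfl⟩ := Multiset.exists_cons_of_mem hw
  obtain ⟨i, j, hij, hi, hB, u, hu, huj⟩ := exists_move hwM hne hMμ hs.1.2
  obtain ⟨W, rfl⟩ := Multiset.exists_cons_of_mem hu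
  have hdown := mshift_lex_down w i j hij hi
  refine sink_contra hs hij huj hi (Or.inl hB) (Or.inl rfl) (Or.inr (Or.inr ⟨hwM, hB, hdown⟩)) ?_
  by_cases huM : u ∈ gensM M
  · exact Or.inr (Or.inr ⟨huM, hB,
      lt_of_lt_of_le ((mLexLt_iff_toLex _ _).1 hdown) (hmin u (by simp) huM)⟩)
  · rcases hs.1.1 u (by simp) with h | h
    · exact absurd h huM
    · exact Or.inl ⟨⟨h, huM⟩, hB⟩

theorem sink_typeN {M N μ : Fin n → ℕ} (hlex : mLexLt N M) (hMμ : mDvd M μ) (hNμ : mDvd N μ)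
    (Z : Multiset (Fin n → ℕ)) (hs : IsSink M N μ Z) (hN : ∀ w ∈ Z, w ∈ gensN M N) : N ∈ Z := by
  have hnon : ∃ w ∈ Z, True := by
    by_contra hcon
    have hZ : Z = 0 := Multiset.eq_zero_of_forall_notMem fun a ha => hcon ⟨a, ha, trivial⟩
    subst hZ
    obtain ⟨i, _, hi⟩ := hlex
    have h1 := hMμ i
    rw [← hs.1.2] at h1
    simp at h1
    omega
  obtain ⟨w, hw, -, hmin⟩ := exists_lex_min Z (fun _ => True) hnon
  by_contra hcon
  have hne : w ≠ N := fun h => hcon (h ▸ hw)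
  obtain ⟨W0, rfl⟩ := Multiset.exists_cons_of_mem hw
  have hwN := hN w hw
  obtain ⟨i, j, hij, hi, hB, u, hu, huj⟩ := exists_move hwN.1 hne hNμ hs.1.2
  obtain ⟨W, rfl⟩ := Multiset.exists_cons_of_mem hu
  have huN := hN u (by simp)
  have hup := mshift_lex_up u i j hij
  have hwu := hmin u (by simp) trivial
  have hB' : InBorel (mshift u j i) N :=
    Relation.ReflTransGen.tail huN.1 ⟨i, j, hij, huj, rfl⟩
  have hall : ∀ x ∈ gensN M N, toLex x ≤ toLex u → varBefore M N x (mshift u j i) := by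
    intro x hx hxu
    by_cases h : mshift u j i ∈ gensM M
    · exact Or.inl ⟨hx, h⟩
    · exact Or.inr (Or.inl ⟨hx, ⟨hB', h⟩, lt_of_le_of_lt hxu ((mLexLt_iff_toLex _ _).1 hup)⟩)
  exact sink_contra hs hij huj hi (Or.inr hB) (Or.inr rfl) (hall w hwN hwu) (hall u huN le_rfl)

/-- Let `I = Borel(M,N)` be a two-Borel ideal (`M`, `N` of the same degree
`d`, `M` lex-earlier than `N`) and let `μ` be divisible by both `M` and `N`.  Then every
sink of `→Γ_μ(I)` of type `M` contains `M` among its elements, every sink of type `N`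
contains `N`, and every sink has the form `{M} ∪ Z_M` with `Z_M` a sink of `→Γ_{μ/M}(I)`,
or `{N} ∪ Z_N` with `Z_N` a sink of `→Γ_{μ/N}(I)`. -/
theorem statement12 (M N μ : Fin n → ℕ) (d : ℕ) (hMd : mDeg M = d) (hNd : mDeg N = d)
    (hlex : mLexLt N M) (hMμ : mDvd M μ) (hNμ : mDvd N μ) :
    (∀ Z, IsSink M N μ Z → (∃ w ∈ Z, w ∈ gensM M) → M ∈ Z) ∧
    (∀ Z, IsSink M N μ Z → (∀ w ∈ Z, w ∈ gensN M N) → N ∈ Z) ∧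
    (∀ Z, IsSink M N μ Z →
      (∃ ZM, Z = M ::ₘ ZM ∧ IsSink M N (μ - M) ZM) ∨
      (∃ ZN, Z = N ::ₘ ZN ∧ IsSink M N (μ - N) ZN)) := by
  have hA := sink_typeM (M := M) (N := N) (μ := μ) hMμ
  have hB := sink_typeN (M := M) (N := N) (μ := μ) hlex hMμ hNμ
  refine ⟨hA, hB, fun Z hs => ?_⟩
  by_cases h : ∃ w ∈ Z, w ∈ gensM M
  · obtain ⟨ZM, rfl⟩ := Multiset.exists_cons_of_mem (hA Z hs h)
    exact Or.inl ⟨ZM, rfl, sink_tail hs⟩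
  · have hN : ∀ w ∈ Z, w ∈ gensN M N := fun w hw => by
      rcases hs.1.1 w hw with h' | h'
      · exact absurd ⟨w, hw, h'⟩ h
      · exact ⟨h', fun h'' => h ⟨w, hw, h''⟩⟩
    obtain ⟨ZN, rfl⟩ := Multiset.exists_cons_of_mem (hB Z hs hN)
    exact Or.inr ⟨ZN, rfl, sink_tail hs⟩
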